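/- Let k be a field of characteristic different from 2. Then the quotient group H³(C₂×C₂, k*) = Z³(C₂×C₂,k*)/B³(C₂×C₂,k*) is isomorphic, as a group, to C₂ × C₂ × C₂ × (k*/k*^{(2)}), where k*^{(2)} = {α² : α ∈ k*}. -/

import Mathlib

def IsCocycle {k : Type*} [Field k] {G : Type*} [Group G] (φ : G → G → G → kˣ) : Prop :=
  ∀ x y z t : G, φ y z t * φ x (y * z) t * φ x y z = φ (x * y) z t * φ x y (z * t)

def IsNormalized {k : Type*} [Field k] {G : Type*} [Group G] (φ : G → G → G → kˣ) : Prop :=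
  ∀ x z : G, φ x 1 z = 1

def d2 {k : Type*} [Field k] {G : Type*} [Group G] (g : G → G → kˣ) : G → G → G → kˣ :=
  fun x y z => g y z * (g (x * y) z)⁻¹ * g x (y * z) * (g x y)⁻¹

def IsCoboundary {k : Type*} [Field k] {G : Type*} [Group G] (φ : G → G → G → kˣ) : Prop :=
  ∃ g : G → G → kˣ, φ = d2 g

/-- The Klein four-group `C₂ × C₂`, written multiplicatively. -/
abbrev K : Type := Multiplicative (ZMod 2 × ZMod 2)

def σ : K := Multiplicative.ofAdd (1, 0)
def τ : K := Multiplicative.ofAdd (0, 1)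
def ρ : K := Multiplicative.ofAdd (1, 1)

/-- The group of 3-cocycles on `G` with coefficients in `kˣ`, under pointwise
multiplication. -/
def Z3 (k : Type*) [Field k] (G : Type*) [Group G] : Subgroup (G → G → G → kˣ) where
  carrier := {φ : G → G → G → kˣ | IsCocycle φ}
  one_mem' := by
    show IsCocycle (1 : G → G → G → kˣ)
    intro x y z t
    simp
  mul_mem' := by
    intro a b ha hb
    replace ha : IsCocycle a := ha
    replace hb : IsCocycle b := hb
    show IsCocycle (a * b)
    intro x y z t
    simp only [Pi.mul_apply]
    simpa only [mul_assoc, mul_left_comm, mul_comm] using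
      congrArg₂ (· * ·) (ha x y z t) (hb x y z t)
  inv_mem' := by
    intro a ha
    replace ha : IsCocycle a := ha
    show IsCocycle a⁻¹
    intro x y z t
    simp only [Pi.inv_apply]
    simpa only [mul_inv, mul_assoc, mul_left_comm, mul_comm] using
      congrArg (·⁻¹) (ha x y z t)

/-- The group of 3-coboundaries on `G` with coefficients in `kˣ`. -/
def B3 (k : Type*) [Field k] (G : Type*) [Group G] : Subgroup (G → G → G → kˣ) where
  carrier := {φ : G → G → G → kˣ | IsCoboundary φ}
  one_mem' := by
    show IsCoboundary (1 : G → G → G → kˣ)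
    exact ⟨1, by funext x y z; simp [d2]⟩
  mul_mem' := by
    intro a b ha hb
    obtain ⟨g, rfl⟩ : IsCoboundary a := ha
    obtain ⟨h, rfl⟩ : IsCoboundary b := hb
    show IsCoboundary (d2 g * d2 h)
    refine ⟨g * h, ?_⟩
    funext x y z
    simp only [d2, Pi.mul_apply, mul_inv, mul_assoc, mul_left_comm, mul_comm]
  inv_mem' := by
    intro a ha
    obtain ⟨g, rfl⟩ : IsCoboundary a := ha
    show IsCoboundary (d2 g)⁻¹
    refine ⟨g⁻¹, ?_⟩
    funext x y z
    simp only [d2, Pi.inv_apply, Pi.mul_apply, mul_inv, inv_inv, mul_assoc, mul_left_comm,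
      mul_comm]

/-- The third cohomology group `H³(G, kˣ) = Z³(G, kˣ)/B³(G, kˣ)`. -/
abbrev H3 (k : Type*) [Field k] (G : Type*) [Group G] :=
  Z3 k G ⧸ (B3 k G).subgroupOf (Z3 k G)

/-- `k*^{(n)} = {α^n : α ∈ k*}`, the subgroup of `n`-th powers in `kˣ`. -/
def powSubgroup (k : Type*) [Field k] (n : ℕ) : Subgroup kˣ where
  carrier := Set.range (· ^ n : kˣ → kˣ)
  one_mem' := ⟨1, one_pow n⟩
  mul_mem' := by
    rintro a b ⟨c, rfl⟩ ⟨d, rfl⟩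
    exact ⟨c * d, mul_pow c d n⟩
  inv_mem' := by
    rintro a ⟨c, rfl⟩
    exact ⟨c⁻¹, inv_pow c n⟩

/-! ### Multiplication table of the Klein group -/

lemma K_cases : ∀ x : K, x = 1 ∨ x = σ ∨ x = τ ∨ x = ρ := by decide

lemma tbl : σ * σ = 1 ∧ σ * τ = ρ ∧ σ * ρ = τ ∧ τ * σ = ρ ∧ τ * τ = 1 ∧ τ * ρ = σ ∧
    ρ * σ = τ ∧ ρ * τ = σ ∧ ρ * ρ = 1 := by decide

lemma ne_tbl : σ ≠ 1 ∧ τ ≠ 1 ∧ ρ ≠ 1 ∧ σ ≠ τ ∧ σ ≠ ρ ∧ τ ≠ σ ∧ τ ≠ ρ ∧ ρ ≠ σ ∧ ρ ≠ τ ∧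
    1 ≠ σ ∧ 1 ≠ τ ∧ 1 ≠ ρ := by decide

/-! ### Additive cochains -/

section additive

variable {A : Type*} [AddCommGroup A]

/-- additive 3-cocycle condition -/
def Coc (F : K → K → K → A) : Prop :=
  ∀ x y z t : K, F y z t + F x (y * z) t + F x y z = F (x * y) z t + F x y (z * t)

/-- additive coboundary -/
def dA (g : K → K → A) (x y z : K) : A := g y z - g (x * y) z + g x (y * z) - g x y

/-- `F` minus the coboundary of `g` -/
def tw (F : K → K → K → A) (g : K → K → A) (x y z : K) : A := F x y z - dA g x y z

lemma Coc.tw {F : K → K → K → A} (H : Coc F) (g : K → K → A) : Coc (tw F g) := by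
  intro x y z t
  have h := H x y z t
  have e : F y z t = F (x * y) z t + F x y (z * t) - F x y z - F x (y * z) t := by
    rw [← h]; abel
  simp only [_root_.tw, dA, e, mul_assoc]
  abel

/-- The four functionals. -/
def fa (F : K → K → K → A) (x : K) : A := F x x x + F x 1 x
def fb (F : K → K → K → A) (x y : K) : A := F x x y - F x y x + F y x x + F y 1 y

lemma fa_tw (F : K → K → K → A) (g : K → K → A) (x : K) (hx : x * x = 1) :
    fa (tw F g) x = fa F x := by
  simp only [fa, tw, dA, hx, mul_one, one_mul]
  abel

lemma fb_tw (F : K → K → K → A) (g : K → K → A) (x y : K) (hx : x * x = 1) :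
    fb (tw F g) x y = fb F x y - (2 : ℤ) • (g x y - g y x) := by
  simp only [fb, tw, dA, hx, mul_comm y x, mul_one, one_mul]
  abel

/-- normalized cochains -/
def Nrm (F : K → K → K → A) : Prop :=
  (∀ y z, F 1 y z = 0) ∧ (∀ x z, F x 1 z = 0) ∧ (∀ x y, F x y 1 = 0)

lemma Nrm.tw {F : K → K → K → A} (hF : Nrm F) {g : K → K → A} (h1 : ∀ x, g 1 x = 0)
    (h2 : ∀ x, g x 1 = 0) : Nrm (tw F g) := by
  obtain ⟨a, b, c⟩ := hF
  refine ⟨fun y z => ?_, fun y z => ?_, fun y z => ?_⟩ <;> simp [_root_.tw, dA, a, b, c, h1, h2]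

lemma exists_nrm {F : K → K → K → A} (H : Coc F) : ∃ g, Nrm (tw F g) ∧ g σ τ = g τ σ := by
  have h111 : F 1 1 1 = 0 := by simpa using H 1 1 1 1
  have hm : ∀ x z, F x 1 z = F 1 1 z + F x 1 1 := by
    intro x z
    have h := H x 1 1 z
    simp only [mul_one, one_mul] at h
    have : F 1 1 z + F x 1 1 + F x 1 z = F x 1 z + F x 1 z := by rw [← h]; abel
    exact (add_right_cancel this).symm
  let g : K → K → A := fun x z => if x = 1 then F 1 1 z else if z = 1 then - F x 1 1 else 0
  have g1 : ∀ z, g 1 z = F 1 1 z := fun z => by simp [g]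
  have g2 : ∀ x, g x 1 = - F x 1 1 := fun x => by
    by_cases hx : x = 1
    · subst hx; simp [g, h111]
    · simp [g, hx]
  have hT := H.tw g
  have n2 : ∀ x z, tw F g x 1 z = 0 := by
    intro x z
    simp only [tw, dA, mul_one, one_mul, g1, g2, hm x z]
    abel
  refine ⟨g, ⟨fun y z => ?_, n2, fun x y => ?_⟩, ?_⟩
  · simpa [n2] using hT 1 1 y z
  · simpa [n2] using hT x y 1 1
  · simp [g, ne_tbl]

lemma eq_zero {F : K → K → K → A} (H : Coc F) (hN : Nrm F)
    (h111 : F σ σ σ = 0) (h222 : F τ τ τ = 0)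
    (h112 : F σ σ τ = 0) (h121 : F σ τ σ = 0) (h122 : F σ τ τ = 0) (h123 : F σ τ ρ = 0)
    (h212 : F τ σ τ = 0) (h211 : F τ σ σ = 0) (h221 : F τ τ σ = 0) :
    ∀ x y z, F x y z = 0 := by
  obtain ⟨n1, n2, n3⟩ := hN
  have h113 : F σ σ ρ = 0 := by simpa [*, tbl] using (H σ σ σ τ).symm
  have h131 : F σ ρ σ = 0 := by simpa [*, tbl] using H σ σ τ σ
  have h132 : F σ ρ τ = 0 := by simpa [*, tbl] using H σ σ τ τ
  have h133 : F σ ρ ρ = 0 := by simpa [*, tbl] using H σ σ τ ρ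
  have h311 : F ρ σ σ = 0 := by simpa [*, tbl] using (H σ τ σ σ).symm
  have h312 : F ρ σ τ = 0 := by simpa [*, tbl] using (H σ τ σ τ).symm
  have h321 : F ρ τ σ = 0 := by simpa [*, tbl] using (H σ τ τ σ).symm
  have h322 : F ρ τ τ = 0 := by simpa [*, tbl] using (H σ τ τ τ).symm
  have h213 : F τ σ ρ = 0 := by simpa [*, tbl] using (H τ σ σ τ).symm
  have h313 : F ρ σ ρ = 0 := by simpa [*, tbl] using (H τ σ σ ρ).symm
  have h231 : F τ ρ σ = 0 := by simpa [*, tbl] using H τ σ τ σ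
  have h232 : F τ ρ τ = 0 := by simpa [*, tbl] using H τ σ τ τ
  have h331 : F ρ ρ σ = 0 := by simpa [*, tbl] using (H τ σ ρ σ).symm
  have h332 : F ρ ρ τ = 0 := by simpa [*, tbl] using (H τ σ ρ τ).symm
  have h223 : F τ τ ρ = 0 := by simpa [*, tbl] using (H τ τ σ τ).symm
  have h233 : F τ ρ ρ = 0 := by simpa [*, tbl] using H τ τ σ ρ
  have h323 : F ρ τ ρ = 0 := by simpa [*, tbl] using H τ ρ τ ρ
  have h333 : F ρ ρ ρ = 0 := by simpa [*, tbl] using H τ ρ ρ ρ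
  intro x y z
  rcases K_cases x with rfl | rfl | rfl | rfl <;>
  rcases K_cases y with rfl | rfl | rfl | rfl <;>
  rcases K_cases z with rfl | rfl | rfl | rfl <;>
  first
  | exact n1 _ _
  | exact n2 _ _
  | exact n3 _ _
  | assumption

lemma exists_cob_nrm {F : K → K → K → A} (H : Coc F) (hN : Nrm F)
    (ha : fa F σ = 0) (hd : fa F τ = 0) (hb : fb F σ τ = 0) (hc : fb F τ σ = 0) :
    ∃ g, ∀ x y z, tw F g x y z = 0 := by
  let g : K → K → A := fun x y =>
    if x = σ then (if y = ρ then F σ σ τ else 0)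
    else if x = τ then (if y = ρ then F τ σ τ - F σ τ τ else 0)
    else if x = ρ then (if y = σ then F σ σ τ - F σ τ σ else if y = τ then - F σ τ τ else
      if y = ρ then F τ σ τ - F σ τ τ - F σ τ ρ else 0)
    else 0
  have hN' : Nrm (tw F g) := hN.tw (fun x => by simp [g, ne_tbl]) (fun x => by simp [g, ne_tbl])
  have ha' := fa_tw F g σ tbl.1
  have hd' := fa_tw F g τ (by decide)
  have hb' := fb_tw F g σ τ tbl.1
  have hc' := fb_tw F g τ σ (by decide)
  have e1 : g σ τ = 0 := by simp [g, ne_tbl]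
  have e2 : g τ σ = 0 := by simp [g, ne_tbl]
  rw [ha] at ha'
  rw [hd] at hd'
  rw [hb, e1, e2] at hb'
  rw [hc, e1, e2] at hc'
  have h112 : tw F g σ σ τ = 0 := by simp [tw, dA, g, tbl, ne_tbl]
  have h121 : tw F g σ τ σ = 0 := by simp [tw, dA, g, tbl, ne_tbl]
  have h122 : tw F g σ τ τ = 0 := by simp [tw, dA, g, tbl, ne_tbl]
  have h123 : tw F g σ τ ρ = 0 := by simp [tw, dA, g, tbl, ne_tbl]
  have h212 : tw F g τ σ τ = 0 := by simp [tw, dA, g, tbl, ne_tbl]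
  refine ⟨g, eq_zero (H.tw g) hN' ?_ ?_ h112 h121 h122 h123 h212 ?_ ?_⟩
  · simpa [fa, hN'.2.1] using ha'
  · simpa [fa, hN'.2.1] using hd'
  · simpa [fb, hN'.2.1, h112, h121] using hb'
  · simpa [fb, hN'.2.1, h122, h212] using hc'

lemma tw_tw (F : K → K → K → A) (g h : K → K → A) : tw (tw F g) h = tw F (g + h) := by
  funext x y z
  simp only [tw, dA, Pi.add_apply]
  abel

/-- Vanishing criterion for a class. -/
lemma exists_cob {F : K → K → K → A} (H : Coc F)
    (ha : fa F σ = 0) (hd : fa F τ = 0) (hbc : fb F σ τ + fb F τ σ = 0)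
    (t : A) (hb : fb F σ τ = (2 : ℤ) • t) :
    ∃ g, ∀ x y z, F x y z = dA g x y z := by
  let g0 : K → K → A := fun x y => if x = σ then (if y = τ then t else 0) else 0
  have e1 : g0 σ τ = t := by simp [g0]
  have e2 : g0 τ σ = 0 := by simp [g0, ne_tbl]
  obtain ⟨g1, hN, hs⟩ := exists_nrm (H.tw g0)
  have hc : fb F τ σ = -((2 : ℤ) • t) := by
    rw [← hb]; exact (neg_eq_of_add_eq_zero_right hbc).symm
  obtain ⟨g2, hg⟩ := exists_cob_nrm ((H.tw g0).tw g1) hN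
    (by rw [fa_tw _ _ _ (by decide), fa_tw _ _ _ (by decide), ha])
    (by rw [fa_tw _ _ _ (by decide), fa_tw _ _ _ (by decide), hd])
    (by rw [fb_tw _ _ _ _ (by decide), fb_tw _ _ _ _ (by decide), hb, e1, e2, hs]; simp)
    (by rw [fb_tw _ _ _ _ (by decide), fb_tw _ _ _ _ (by decide), hc, e1, e2, hs]; simp)
  rw [tw_tw, tw_tw] at hg
  exact ⟨_, fun x y z => sub_eq_zero.1 (hg x y z)⟩

/-- Torsion relations. -/
lemma torsion_nrm {F : K → K → K → A} (H : Coc F) (hN : Nrm F) :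
    fa F σ + fa F σ = 0 ∧ fa F τ + fa F τ = 0 ∧
      (fb F σ τ + fb F τ σ) + (fb F σ τ + fb F τ σ) = 0 := by
  obtain ⟨n1, n2, n3⟩ := hN
  refine ⟨by simpa [fa, n1, n2, n3, tbl] using H σ σ σ σ,
    by simpa [fa, n1, n2, n3, tbl] using H τ τ τ τ, ?_⟩
  have e1 := sub_eq_zero.2 (H σ σ τ τ)
  have e2 := sub_eq_zero.2 (H σ τ σ τ)
  have e3 := sub_eq_zero.2 (H σ τ τ σ)
  have e4 := sub_eq_zero.2 (H τ σ σ τ)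
  have e5 := sub_eq_zero.2 (H τ σ τ σ)
  have e6 := sub_eq_zero.2 (H τ τ σ σ)
  simp only [tbl, n1, n2, n3, fb] at e1 e2 e3 e4 e5 e6 ⊢
  linear_combination (norm := abel) e1 - e2 + e3 + e4 - e5 + e6

lemma torsion {F : K → K → K → A} (H : Coc F) :
    fa F σ + fa F σ = 0 ∧ fa F τ + fa F τ = 0 ∧
      (fb F σ τ + fb F τ σ) + (fb F σ τ + fb F τ σ) = 0 := by
  obtain ⟨g, hN, hs⟩ := exists_nrm H
  have h := torsion_nrm (H.tw g) hN
  rw [fa_tw _ _ _ (by decide), fa_tw _ _ _ (by decide), fb_tw _ _ _ _ (by decide),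
    fb_tw _ _ _ _ (by decide), hs] at h
  simpa using h

end additive

/-! ### Multiplicative version -/

section mult

variable {k : Type*} [Field k]

def ma (x : K) : (K → K → K → kˣ) →* kˣ where
  toFun F := F x x x * F x 1 x
  map_one' := by simp
  map_mul' F G := by simp only [Pi.mul_apply]; exact mul_mul_mul_comm _ _ _ _

def mb (x y : K) : (K → K → K → kˣ) →* kˣ where
  toFun F := F x x y / F x y x * F y x x * F y 1 y
  map_one' := by simp
  map_mul' F G := by
    simp only [Pi.mul_apply, div_eq_mul_inv, mul_inv]
    simp only [mul_assoc, mul_left_comm, mul_comm]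

def mbc : (K → K → K → kˣ) →* kˣ := mb σ τ * mb τ σ

lemma mtorsion {F : K → K → K → kˣ} (H : IsCocycle F) :
    ma σ F ^ 2 = 1 ∧ ma τ F ^ 2 = 1 ∧ mbc F ^ 2 = 1 := by
  have h := torsion (A := Additive kˣ) (F := F) H
  rw [sq, sq, sq]
  exact h

lemma mcob {F : K → K → K → kˣ} (H : IsCocycle F) (ha : ma σ F = 1) (hd : ma τ F = 1)
    (hbc : mbc F = 1) (t : kˣ) (hb : mb σ τ F = t ^ 2) : IsCoboundary F := by
  obtain ⟨g, hg⟩ := exists_cob (A := Additive kˣ) (F := F) H ha hd hbc t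
    (hb.trans (zpow_ofNat t 2).symm)
  refine ⟨g, ?_⟩
  funext x y z
  have h := hg x y z
  unfold dA at h
  rw [sub_eq_add_neg, sub_eq_add_neg] at h
  exact h

lemma mcob_conv (g : K → K → kˣ) : ma σ (d2 g) = 1 ∧ ma τ (d2 g) = 1 ∧ mbc (d2 g) = 1 ∧
    mb σ τ (d2 g) = (g σ τ / g τ σ) ^ 2 := by
  refine ⟨?_, ?_, ?_, ?_⟩
  · simp only [ma, d2, tbl, MonoidHom.coe_mk, OneHom.coe_mk, mul_one, one_mul]
    ext
    push_cast
    field_simp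
  · simp only [ma, d2, tbl, MonoidHom.coe_mk, OneHom.coe_mk, mul_one, one_mul]
    ext
    push_cast
    field_simp
  · simp only [mbc, mb, d2, tbl, MonoidHom.mul_apply, MonoidHom.coe_mk, OneHom.coe_mk, mul_one, one_mul]
    ext
    push_cast
    field_simp
  · simp only [mb, d2, tbl, MonoidHom.coe_mk, OneHom.coe_mk, mul_one, one_mul]
    ext
    push_cast
    field_simp

/-- first and second bits -/
def b1 (x : K) : ℕ := (Multiplicative.toAdd x).1.val
def b2 (x : K) : ℕ := (Multiplicative.toAdd x).2.val

def stdF (a d e b : kˣ) : K → K → K → kˣ :=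
  (fun x y z => a ^ (b1 x * b1 y * b1 z)) * (fun x y z => d ^ (b2 x * b2 y * b2 z)) *
  (fun x y z => e ^ (b1 x * b2 y * b2 z)) *
  (fun x y z => b ^ ((b1 x * b1 y * b2 z : ℤ) - (b1 x * b2 y * b2 z : ℤ)))

lemma stdF_coc (a d e b : kˣ) (ha : a ^ 2 = 1) (hd : d ^ 2 = 1) (he : e ^ 2 = 1) :
    IsCocycle (stdF a d e b) := by
  have key : ∀ (u : kˣ) (m n : ℕ), u ^ 2 = 1 → m % 2 = n % 2 → u ^ m = u ^ n := by
    intro u m n hu h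
    rw [pow_eq_pow_mod m hu, pow_eq_pow_mod n hu, h]
  have D1 : ∀ x y z t : K, (b1 y * b1 z * b1 t + b1 x * b1 (y * z) * b1 t + b1 x * b1 y * b1 z) % 2
      = (b1 (x * y) * b1 z * b1 t + b1 x * b1 y * b1 (z * t)) % 2 := by decide
  have D2 : ∀ x y z t : K, (b2 y * b2 z * b2 t + b2 x * b2 (y * z) * b2 t + b2 x * b2 y * b2 z) % 2
      = (b2 (x * y) * b2 z * b2 t + b2 x * b2 y * b2 (z * t)) % 2 := by decide
  have D3 : ∀ x y z t : K, (b1 y * b2 z * b2 t + b1 x * b2 (y * z) * b2 t + b1 x * b2 y * b2 z) % 2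
      = (b1 (x * y) * b2 z * b2 t + b1 x * b2 y * b2 (z * t)) % 2 := by decide
  have D4 : ∀ x y z t : K,
      ((b1 y * b1 z * b2 t : ℤ) - (b1 y * b2 z * b2 t : ℤ)) +
      ((b1 x * b1 (y * z) * b2 t : ℤ) - (b1 x * b2 (y * z) * b2 t : ℤ)) +
      ((b1 x * b1 y * b2 z : ℤ) - (b1 x * b2 y * b2 z : ℤ)) =
      ((b1 (x * y) * b1 z * b2 t : ℤ) - (b1 (x * y) * b2 z * b2 t : ℤ)) +
      ((b1 x * b1 y * b2 (z * t) : ℤ) - (b1 x * b2 y * b2 (z * t) : ℤ)) := by decide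
  refine (Z3 k K).mul_mem ((Z3 k K).mul_mem ((Z3 k K).mul_mem ?_ ?_) ?_) ?_ <;> intro x y z t
  · simpa only [pow_add] using key a _ _ ha (D1 x y z t)
  · simpa only [pow_add] using key d _ _ hd (D2 x y z t)
  · simpa only [pow_add] using key e _ _ he (D3 x y z t)
  · simpa only [zpow_add] using congrArg (fun n : ℤ => b ^ n) (D4 x y z t)

lemma stdF_val (a d e b : kˣ) : ma σ (stdF a d e b) = a ∧ ma τ (stdF a d e b) = d ∧
    mbc (stdF a d e b) = e ∧ mb σ τ (stdF a d e b) = b := by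
  have v : b1 σ = 1 ∧ b1 τ = 0 ∧ b1 1 = 0 ∧ b2 σ = 0 ∧ b2 τ = 1 ∧ b2 1 = 0 := by decide
  simp [ma, mb, mbc, stdF, v]

end mult

lemma equivC2 (k : Type*) [Field k] (hk : ringChar k ≠ 2) :
    Nonempty (rootsOfUnity 2 k ≃* Multiplicative (ZMod 2)) := by
  have : NeZero (2 : k) := ⟨Ring.two_ne_zero hk⟩
  have hp : IsPrimitiveRoot (-1 : k) 2 := IsPrimitiveRoot.neg_one (ringChar k) hk
  have h1 : Nat.card (rootsOfUnity 2 k) = 2 := hp.card_rootsOfUnity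
  have : Fact (Nat.Prime 2) := ⟨Nat.prime_two⟩
  exact ⟨mulEquivOfPrimeCardEq (p := 2) h1 (by simp)⟩

/-- First isomorphism theorem for a product of homomorphisms. -/
lemma iso_prod {G M C Q : Type*} [Group G] [Group M] [Group C] [Group Q] (N : Subgroup G)
    [N.Normal] (E : M ≃* C) (f : G →* M × M × M × Q) (hN : f.ker = N)
    (hf : Function.Surjective f) : Nonempty (G ⧸ N ≃* C × C × C × Q) := by
  subst hN
  exact ⟨(QuotientGroup.quotientKerEquivOfSurjective f hf).trans
    (E.prodCongr (E.prodCongr (E.prodCongr (MulEquiv.refl Q))))⟩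

/-- The classifying homomorphism. -/
noncomputable def cls (k : Type*) [Field k] : Z3 k K →*
    rootsOfUnity 2 k × rootsOfUnity 2 k × rootsOfUnity 2 k × (kˣ ⧸ powSubgroup k 2) :=
  MonoidHom.prod (((ma σ).comp (Z3 k K).subtype).codRestrict _ fun F => (mtorsion F.2).1)
  (MonoidHom.prod (((ma τ).comp (Z3 k K).subtype).codRestrict _ fun F => (mtorsion F.2).2.1)
  (MonoidHom.prod ((mbc.comp (Z3 k K).subtype).codRestrict _ fun F => (mtorsion F.2).2.2)
  ((QuotientGroup.mk' _).comp ((mb σ τ).comp (Z3 k K).subtype))))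

lemma cls_ker (k : Type*) [Field k] : (cls k).ker = (B3 k K).subgroupOf (Z3 k K) := by
  ext ⟨F, hF⟩
  rw [MonoidHom.mem_ker, Subgroup.mem_subgroupOf]
  simp only [cls, MonoidHom.prod_apply, Prod.mk_eq_one, Subtype.ext_iff]
  constructor
  · rintro ⟨ha, hd, he, hb⟩
    obtain ⟨t, ht⟩ := (QuotientGroup.eq_one_iff _).1 hb
    exact mcob hF ha hd he t ht.symm
  · rintro ⟨g, hg⟩
    have hg' : F = d2 g := hg
    subst hg'
    obtain ⟨ha, hd, he, hb⟩ := mcob_conv g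
    exact ⟨ha, hd, he, (QuotientGroup.eq_one_iff _).2 ⟨_, hb.symm⟩⟩

lemma cls_surj (k : Type*) [Field k] : Function.Surjective (cls k) := by
  rintro ⟨⟨a, ha⟩, ⟨d, hd⟩, ⟨e, he⟩, b⟩
  obtain ⟨b, rfl⟩ := QuotientGroup.mk_surjective b
  refine ⟨⟨stdF a d e b, stdF_coc a d e b ha hd he⟩, ?_⟩
  obtain ⟨h1, h2, h3, h4⟩ := stdF_val a d e b
  exact Prod.ext (Subtype.ext h1) (Prod.ext (Subtype.ext h2) (Prod.ext (Subtype.ext h3)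
    (congrArg (QuotientGroup.mk' (powSubgroup k 2)) h4)))

theorem statement12 (k : Type*) [Field k] (hk : ringChar k ≠ 2) :
    Nonempty (H3 k K ≃*
      Multiplicative (ZMod 2) × Multiplicative (ZMod 2) × Multiplicative (ZMod 2)
        × (kˣ ⧸ powSubgroup k 2)) := by
  obtain ⟨E⟩ := equivC2 k hk
  exact iso_prod _ E (cls k) (cls_ker k) (cls_surj k)
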